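/- First Lamé pair: let λ, μ be real with μ ≠ 0, γ = (λ+μ)/μ ≠ 0, let D ⊆ ℝ² be open, and let U₁, U₂, U₃, U₄ : D → ℝ be twice continuously differentiable functions satisfying the Cauchy–Riemann-type system (CR) on D. Define u = (2/γ)·U₁ − ((2+γ)/γ)·U₄ and v = U₂, and θ = ∂u/∂x + ∂v/∂y. Then (u, v) solves the Lamé equilibrium system in D: Δu + γ·∂θ/∂x = 0 and Δv + γ·∂θ/∂y = 0. -/

import Mathlib

/- Lamé equilibrium pairs built from the components of a monogenic 𝔹-valued
   function (Theorem 1 of [Gr-dop-15]). -/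

noncomputable section

/-- The partial derivative in `x` of a function `ℝ² → ℝ`. -/
def pdx (f : ℝ × ℝ → ℝ) : ℝ × ℝ → ℝ := fun p => fderiv ℝ f p (1, 0)

/-- The partial derivative in `y` of a function `ℝ² → ℝ`. -/
def pdy (f : ℝ × ℝ → ℝ) : ℝ × ℝ → ℝ := fun p => fderiv ℝ f p (0, 1)

/-- The Cauchy–Riemann-type system for the components `U₁, U₂, U₃, U₄`. -/
def CRsys (U₁ U₂ U₃ U₄ : ℝ × ℝ → ℝ) (p : ℝ × ℝ) : Prop :=
  pdy U₁ p = pdx U₃ p ∧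
  pdy U₂ p = pdx U₄ p ∧
  pdy U₃ p = pdx U₁ p - 2 * pdx U₄ p ∧
  pdy U₄ p = pdx U₂ p + 2 * pdx U₃ p

/-- Directional derivatives at a point depend only on the values of the function on a
neighbourhood of that point. -/
theorem fderiv_apply_congr_on {D : Set (ℝ × ℝ)} (hD : IsOpen D) {f g : ℝ × ℝ → ℝ}
    (hfg : ∀ q ∈ D, f q = g q) {p : ℝ × ℝ} (hp : p ∈ D) (e : ℝ × ℝ) :
    fderiv ℝ f p e = fderiv ℝ g p e := by
  have h : f =ᶠ[nhds p] g := by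
    filter_upwards [hD.mem_nhds hp] with q hq using hfg q hq
  rw [h.fderiv_eq]

theorem fderiv_apply_linear_comb {f g : ℝ × ℝ → ℝ} {p : ℝ × ℝ}
    (hf : DifferentiableAt ℝ f p) (hg : DifferentiableAt ℝ g p) (a b : ℝ) (e : ℝ × ℝ) :
    fderiv ℝ (fun q => a * f q + b * g q) p e = a * fderiv ℝ f p e + b * fderiv ℝ g p e := by
  rw [((hf.hasFDerivAt.const_mul a).fun_add (hg.hasFDerivAt.const_mul b)).fderiv]
  simp

theorem differentiableAt_fderiv_of_contDiffAt {f : ℝ × ℝ → ℝ} {p : ℝ × ℝ}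
    (hf : ContDiffAt ℝ 2 f p) : DifferentiableAt ℝ (fderiv ℝ f) p :=
  (hf.fderiv_right (m := 1) (by norm_num)).differentiableAt (by norm_num)

theorem differentiableAt_pdx {f : ℝ × ℝ → ℝ} {p : ℝ × ℝ} (hf : ContDiffAt ℝ 2 f p) :
    DifferentiableAt ℝ (pdx f) p :=
  (differentiableAt_fderiv_of_contDiffAt hf).clm_apply (differentiableAt_const _)

theorem differentiableAt_pdy {f : ℝ × ℝ → ℝ} {p : ℝ × ℝ} (hf : ContDiffAt ℝ 2 f p) :
    DifferentiableAt ℝ (pdy f) p :=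
  (differentiableAt_fderiv_of_contDiffAt hf).clm_apply (differentiableAt_const _)

/-- Symmetry of the mixed second partial derivatives of a `C²` function. -/
theorem pdx_pdy_comm {f : ℝ × ℝ → ℝ} {p : ℝ × ℝ} (hf : ContDiffAt ℝ 2 f p) :
    pdx (pdy f) p = pdy (pdx f) p := by
  have hd := differentiableAt_fderiv_of_contDiffAt hf
  have key (e e' : ℝ × ℝ) :
      fderiv ℝ (fun q => fderiv ℝ f q e) p e' = fderiv ℝ (fderiv ℝ f) p e' e := by
    rw [fderiv_clm_apply hd (differentiableAt_const e)]
    simp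
  change fderiv ℝ (fun q => fderiv ℝ f q (0, 1)) p (1, 0) =
    fderiv ℝ (fun q => fderiv ℝ f q (1, 0)) p (0, 1)
  rw [key, key]
  exact (hf.isSymmSndFDerivAt (by simp)) (1, 0) (0, 1)

/-- First Lamé pair: with `γ = (λ+μ)/μ ≠ 0`, the pair
`u = (2/γ)U₁ − ((2+γ)/γ)U₄`, `v = U₂` built from C² components of a monogenic
function satisfies the Lamé equilibrium system
`Δu + γθₓ = 0`, `Δv + γθ_y = 0`, where `θ = uₓ + v_y`. -/
theorem first_Lame_pair (lam μ : ℝ) (hμ : μ ≠ 0)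
    (γ : ℝ) (hγdef : γ = (lam + μ) / μ) (hγ : γ ≠ 0)
    (D : Set (ℝ × ℝ)) (hD : IsOpen D)
    (U₁ U₂ U₃ U₄ : ℝ × ℝ → ℝ)
    (h₁ : ContDiffOn ℝ 2 U₁ D) (h₂ : ContDiffOn ℝ 2 U₂ D)
    (h₃ : ContDiffOn ℝ 2 U₃ D) (h₄ : ContDiffOn ℝ 2 U₄ D)
    (hCR : ∀ p ∈ D, CRsys U₁ U₂ U₃ U₄ p)
    (u v θ : ℝ × ℝ → ℝ)
    (hu : u = fun p => (2 / γ) * U₁ p - ((2 + γ) / γ) * U₄ p)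
    (hv : v = U₂)
    (hθ : θ = fun p => pdx u p + pdy v p) :
    ∀ p ∈ D,
      pdx (pdx u) p + pdy (pdy u) p + γ * pdx θ p = 0 ∧
      pdx (pdx v) p + pdy (pdy v) p + γ * pdy θ p = 0 := by
  have c₁ q (hq : q ∈ D) := h₁.contDiffAt (hD.mem_nhds hq)
  have c₂ q (hq : q ∈ D) := h₂.contDiffAt (hD.mem_nhds hq)
  have c₃ q (hq : q ∈ D) := h₃.contDiffAt (hD.mem_nhds hq)
  have c₄ q (hq : q ∈ D) := h₄.contDiffAt (hD.mem_nhds hq)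
  have hu' : u = fun q => (2 / γ) * U₁ q + (-((2 + γ) / γ)) * U₄ q := by
    rw [hu]; funext q; ring
  have u_deriv (e : ℝ × ℝ) q (hq : q ∈ D) : fderiv ℝ u q e =
      (2 / γ) * fderiv ℝ U₁ q e + (-((2 + γ) / γ)) * fderiv ℝ U₄ q e := by
    rw [hu']
    exact fderiv_apply_linear_comb ((c₁ q hq).differentiableAt (by norm_num))
      ((c₄ q hq).differentiableAt (by norm_num)) _ _ e
  -- On `D` the dilatation reduces to `(2/γ)(∂ₓU₁ - ∂ₓU₄)`.
  have θ_eq q (hq : q ∈ D) : θ q = (2 / γ) * pdx U₁ q + (-(2 / γ)) * pdx U₄ q := by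
    have hux : pdx u q = (2 / γ) * pdx U₁ q + (-((2 + γ) / γ)) * pdx U₄ q :=
      u_deriv (1, 0) q hq
    rw [hθ]
    simp only [hux, hv, (hCR q hq).2.1]
    field_simp
    ring
  intro p hp
  have x₁ := differentiableAt_pdx (c₁ p hp)
  have x₂ := differentiableAt_pdx (c₂ p hp)
  have x₃ := differentiableAt_pdx (c₃ p hp)
  have x₄ := differentiableAt_pdx (c₄ p hp)
  have y₁ := differentiableAt_pdy (c₁ p hp)
  have y₄ := differentiableAt_pdy (c₄ p hp)
  have uxx : pdx (pdx u) p =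
      (2 / γ) * pdx (pdx U₁) p + (-((2 + γ) / γ)) * pdx (pdx U₄) p :=
    (fderiv_apply_congr_on hD (u_deriv (1, 0)) hp _).trans
      (fderiv_apply_linear_comb x₁ x₄ _ _ _)
  have uyy : pdy (pdy u) p =
      (2 / γ) * pdy (pdy U₁) p + (-((2 + γ) / γ)) * pdy (pdy U₄) p :=
    (fderiv_apply_congr_on hD (u_deriv (0, 1)) hp _).trans
      (fderiv_apply_linear_comb y₁ y₄ _ _ _)
  have θ_deriv (e : ℝ × ℝ) : fderiv ℝ θ p e =
      (2 / γ) * fderiv ℝ (pdx U₁) p e + (-(2 / γ)) * fderiv ℝ (pdx U₄) p e :=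
    (fderiv_apply_congr_on hD θ_eq hp e).trans (fderiv_apply_linear_comb x₁ x₄ _ _ e)
  have θx : pdx θ p = (2 / γ) * pdx (pdx U₁) p + (-(2 / γ)) * pdx (pdx U₄) p :=
    θ_deriv (1, 0)
  have θy : pdy θ p = (2 / γ) * pdy (pdx U₁) p + (-(2 / γ)) * pdy (pdx U₄) p :=
    θ_deriv (0, 1)
  -- The derivatives of the four equations of the Cauchy–Riemann-type system.
  have d₁ (e : ℝ × ℝ) : fderiv ℝ (pdy U₁) p e = fderiv ℝ (pdx U₃) p e :=
    fderiv_apply_congr_on hD (fun q hq => (hCR q hq).1) hp e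
  have d₂ (e : ℝ × ℝ) : fderiv ℝ (pdy U₂) p e = fderiv ℝ (pdx U₄) p e :=
    fderiv_apply_congr_on hD (fun q hq => (hCR q hq).2.1) hp e
  have d₃ (e : ℝ × ℝ) : fderiv ℝ (pdy U₃) p e =
      1 * fderiv ℝ (pdx U₁) p e + (-2) * fderiv ℝ (pdx U₄) p e :=
    (fderiv_apply_congr_on hD (fun q hq => (hCR q hq).2.2.1.trans (by ring)) hp e).trans
      (fderiv_apply_linear_comb x₁ x₄ 1 (-2) e)
  have d₄ (e : ℝ × ℝ) : fderiv ℝ (pdy U₄) p e =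
      1 * fderiv ℝ (pdx U₂) p e + 2 * fderiv ℝ (pdx U₃) p e :=
    (fderiv_apply_congr_on hD (fun q hq => (hCR q hq).2.2.2.trans (by ring)) hp e).trans
      (fderiv_apply_linear_comb x₂ x₃ 1 2 e)
  have d₁x : pdx (pdy U₁) p = pdx (pdx U₃) p := d₁ (1, 0)
  have d₁y : pdy (pdy U₁) p = pdy (pdx U₃) p := d₁ (0, 1)
  have d₂x : pdx (pdy U₂) p = pdx (pdx U₄) p := d₂ (1, 0)
  have d₂y : pdy (pdy U₂) p = pdy (pdx U₄) p := d₂ (0, 1)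
  have d₃x : pdx (pdy U₃) p = 1 * pdx (pdx U₁) p + (-2) * pdx (pdx U₄) p := d₃ (1, 0)
  have d₄x : pdx (pdy U₄) p = 1 * pdx (pdx U₂) p + 2 * pdx (pdx U₃) p := d₄ (1, 0)
  have d₄y : pdy (pdy U₄) p = 1 * pdy (pdx U₂) p + 2 * pdy (pdx U₃) p := d₄ (0, 1)
  have s₁ := pdx_pdy_comm (c₁ p hp)
  have s₂ := pdx_pdy_comm (c₂ p hp)
  have s₃ := pdx_pdy_comm (c₃ p hp)
  have s₄ := pdx_pdy_comm (c₄ p hp)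
  constructor
  · rw [uxx, uyy, θx, d₁y, d₄y, ← s₂, ← s₃, d₂x, d₃x]
    field_simp
    ring
  · rw [hv, θy, d₂y, ← s₁, ← s₄, d₁x, d₄x]
    field_simp
    ring
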